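/- arXiv:2408.11694 — 2 statements merged into one kernel-verified Lean document; each statement's English description precedes it below -/
import Mathlib

section
/- Let B be a uniformly convex real Banach space, G a nonempty a.s. bounded closed L⁰-convex subset of L⁰(𝓕,B), and 𝒯 a family of nonexpansive mappings from G to G such that T∘S = S∘T for all T, S ∈ 𝒯. Then 𝒯 has a common fixed point: there exists x ∈ G with T(x) = x for every T ∈ 𝒯. -/
open MeasureTheory Set Filter Function
open scoped Classical

noncomputable section

namespace RNM


variable {Ω : Type*} [MeasurableSpace Ω] {P : Measure Ω}
variable {B : Type*} [NormedAddCommGroup B] [NormedSpace ℝ B]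

/-- The pointwise norm of `x ∈ L⁰(𝓕,B)` as an element of `L⁰(𝓕,ℝ)`. -/
def nrm (x : Ω →ₘ[P] B) : Ω →ₘ[P] ℝ := x.comp norm continuous_norm

/-- The module action of `L⁰(𝓕,ℝ)` on `L⁰(𝓕,B)` (pointwise scalar multiplication). -/
def msmul (l : Ω →ₘ[P] ℝ) (x : Ω →ₘ[P] B) : Ω →ₘ[P] B :=
  AEEqFun.comp₂ (fun c (b : B) => c • b) continuous_smul l x

/-- `Ĩ_A`, the equivalence class of the indicator function of `A`, in `L⁰(𝓕,ℝ)`. -/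
def ind (A : Set Ω) (hA : MeasurableSet A) : Ω →ₘ[P] ℝ :=
  AEEqFun.mk (A.indicator fun _ => (1 : ℝ))
    ((measurable_const.indicator hA).aestronglyMeasurable)

/-- A subset of `L⁰(𝓕,B)` is a.s. bounded if the norms of its members have a common
bound in `L⁰(𝓕,ℝ)`. -/
def ASBounded (H : Set (Ω →ₘ[P] B)) : Prop :=
  ∃ ξ : Ω →ₘ[P] ℝ, ∀ h ∈ H, nrm h ≤ ξ

/-- The supremum of a subset of `L⁰(𝓕,ℝ)` (junk value `0` if no least upper bound exists;
for nonempty a.s. bounded-above sets the least upper bound always exists, by Dedekind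
completeness of `L⁰(𝓕,ℝ)`). -/
def lsup (S : Set (Ω →ₘ[P] ℝ)) : Ω →ₘ[P] ℝ :=
  if h : ∃ ξ, IsLUB S ξ then h.choose else 0

/-- The infimum of a subset of `L⁰(𝓕,ℝ)` (junk value `0` if no greatest lower bound exists). -/
def linf (S : Set (Ω →ₘ[P] ℝ)) : Ω →ₘ[P] ℝ :=
  if h : ∃ ξ, IsGLB S ξ then h.choose else 0

/-- The random Chebyshev radius `R(H,x)` of `H` at `x`. -/
def Rr (H : Set (Ω →ₘ[P] B)) (x : Ω →ₘ[P] B) : Ω →ₘ[P] ℝ :=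
  lsup ((fun y => nrm (x - y)) '' H)

/-- The random Chebyshev radius `R(H,G)` of `H` with respect to `G`. -/
def RrS (H G : Set (Ω →ₘ[P] B)) : Ω →ₘ[P] ℝ :=
  linf ((fun x => Rr H x) '' G)

/-- The random Chebyshev center `C(H,G)` of `H` with respect to `G`. -/
def Cc (H G : Set (Ω →ₘ[P] B)) : Set (Ω →ₘ[P] B) :=
  {x ∈ G | Rr H x = RrS H G}

/-- The random diameter `D(H)`. -/
def Dd (H : Set (Ω →ₘ[P] B)) : Ω →ₘ[P] ℝ :=
  lsup {ξ | ∃ x ∈ H, ∃ y ∈ H, ξ = nrm (x - y)}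

/-- A subset of `L⁰(𝓕,B)` is closed if it is sequentially closed under convergence in
probability (the `(ε,λ)`-topology). -/
def SeqClosed (S : Set (Ω →ₘ[P] B)) : Prop :=
  ∀ (x : ℕ → Ω →ₘ[P] B) (y : Ω →ₘ[P] B), (∀ n, x n ∈ S) →
    TendstoInMeasure P (fun n => (x n : Ω → B)) atTop y → y ∈ S

/-- The closure of a subset of `L⁰(𝓕,B)` under convergence in probability. -/
def seqClosure (S : Set (Ω →ₘ[P] B)) : Set (Ω →ₘ[P] B) :=
  {y | ∃ x : ℕ → Ω →ₘ[P] B, (∀ n, x n ∈ S) ∧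
    TendstoInMeasure P (fun n => (x n : Ω → B)) atTop y}

/-- `L⁰`-convexity. -/
def LConvex (G : Set (Ω →ₘ[P] B)) : Prop :=
  ∀ x ∈ G, ∀ y ∈ G, ∀ l : Ω →ₘ[P] ℝ, 0 ≤ l → l ≤ 1 →
    msmul l x + msmul (1 - l) y ∈ G

/-- `L⁰`-convex compactness: `G` is a nonempty closed `L⁰`-convex set such that every family
of nonempty closed `L⁰`-convex subsets of `G` with the finite intersection property has
nonempty intersection. -/
def ConvexlyCompact (G : Set (Ω →ₘ[P] B)) : Prop :=
  G.Nonempty ∧ SeqClosed G ∧ LConvex G ∧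
    ∀ 𝒞 : Set (Set (Ω →ₘ[P] B)),
      (∀ C ∈ 𝒞, C.Nonempty ∧ C ⊆ G ∧ SeqClosed C ∧ LConvex C) →
      (∀ S : Finset (Set (Ω →ₘ[P] B)), ↑S ⊆ 𝒞 → (⋂₀ (S : Set (Set (Ω →ₘ[P] B)))).Nonempty) →
      (⋂₀ 𝒞).Nonempty

/-- Random normal structure. -/
def RandNormalStructure (G : Set (Ω →ₘ[P] B)) : Prop :=
  ∀ H ⊆ G, H.Nonempty → ASBounded H → SeqClosed H → LConvex H → Dd H ≠ 0 →
    ∃ z ∈ H, ∀ᵐ ω ∂P, 0 < Dd H ω → Rr H z ω < Dd H ω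

/-- A nonexpansive mapping (on `G`). -/
def NonexpansiveOn (G : Set (Ω →ₘ[P] B)) (T : (Ω →ₘ[P] B) → (Ω →ₘ[P] B)) : Prop :=
  ∀ x ∈ G, ∀ y ∈ G, nrm (T x - T y) ≤ nrm (x - y)

/-- An isometric mapping (on `G`). -/
def IsometricOn (G : Set (Ω →ₘ[P] B)) (T : (Ω →ₘ[P] B) → (Ω →ₘ[P] B)) : Prop :=
  ∀ x ∈ G, ∀ y ∈ G, nrm (T x - T y) = nrm (x - y)

/-- A countable measurable partition of `Ω`. -/
def IsPartition (A : ℕ → Set Ω) : Prop :=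
  (∀ n, MeasurableSet (A n)) ∧ Pairwise (Disjoint on A) ∧ (⋃ n, A n) = univ

/-- `y` is the countable concatenation `Σ_n Ĩ_{A_n} x_n`,
i.e. `y` agrees a.s. with `x n` on `A n` for each `n`. -/
def IsConcat (A : ℕ → Set Ω) (x : ℕ → Ω →ₘ[P] B) (y : Ω →ₘ[P] B) : Prop :=
  ∀ n, ∀ᵐ ω ∂P, ω ∈ A n → y ω = x n ω

/-- `G` is σ-stable: it contains all countable concatenations of its members along
countable measurable partitions of `Ω`. -/
def SigmaStable (G : Set (Ω →ₘ[P] B)) : Prop :=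
  ∀ A : ℕ → Set Ω, IsPartition A → ∀ x : ℕ → Ω →ₘ[P] B, (∀ n, x n ∈ G) →
    ∀ y, IsConcat A x y → y ∈ G

/-- The σ-stable hull of `G`. -/
def sigmaHull (G : Set (Ω →ₘ[P] B)) : Set (Ω →ₘ[P] B) :=
  {y | ∃ A : ℕ → Set Ω, IsPartition A ∧
    ∃ x : ℕ → Ω →ₘ[P] B, (∀ n, x n ∈ G) ∧ IsConcat A x y}

/-- The countable concatenation `Σ_n Ĩ_{A_n} H_n` of a sequence of sets. -/
def concatSet (A : ℕ → Set Ω) (H : ℕ → Set (Ω →ₘ[P] B)) : Set (Ω →ₘ[P] B) :=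
  {y | ∃ x : ℕ → Ω →ₘ[P] B, (∀ n, x n ∈ H n) ∧ IsConcat A x y}

/-- A finitely stable subset of `L⁰(𝓕,B)`. -/
def FinStable (G : Set (Ω →ₘ[P] B)) : Prop :=
  ∀ x ∈ G, ∀ y ∈ G, ∀ A : Set Ω, ∀ hA : MeasurableSet A,
    msmul (ind A hA) x + msmul (ind Aᶜ hA.compl) y ∈ G


/-- Quantitative convexity inequality for the squared norm. -/
def UCsq (E : Type*) [NormedAddCommGroup E] [NormedSpace ℝ E] : Prop :=
  ∀ ε : ℝ, 0 < ε → ∃ C : ℝ, 0 < C ∧ ∀ a b : E,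
    ‖a - b‖ ^ 2 ≤ ε * (‖a‖ ^ 2 + ‖b‖ ^ 2) +
      C * ((‖a‖ ^ 2 + ‖b‖ ^ 2) / 2 - ‖(1 / 2 : ℝ) • (a + b)‖ ^ 2)

lemma ucsq_of_uniformConvex (E : Type*) [NormedAddCommGroup E] [NormedSpace ℝ E]
    [UniformConvexSpace E] : UCsq E := by
  intro ε hε
  obtain ⟨δ₀, hδ₀, h₀⟩ := exists_forall_closed_ball_dist_add_le_two_sub E (Real.sqrt_pos.2 hε)
  obtain ⟨δ, hδ, hδ1, hδδ⟩ : ∃ δ : ℝ, 0 < δ ∧ δ ≤ 1 ∧ δ ≤ δ₀ :=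
    ⟨min 1 δ₀, lt_min one_pos hδ₀, min_le_left _ _, min_le_right _ _⟩
  -- normalized version
  have key : ∀ a b : E, ‖a‖ = 1 → ‖b‖ ≤ 1 →
      ‖a - b‖ ^ 2 ≤ ε * (‖a‖ ^ 2 + ‖b‖ ^ 2) +
      256 / δ ^ 2 * ((‖a‖ ^ 2 + ‖b‖ ^ 2) / 2 - ‖(1 / 2 : ℝ) • (a + b)‖ ^ 2) := by
    intro a b ha hb
    have hn : ‖(1 / 2 : ℝ) • (a + b)‖ = ‖a + b‖ / 2 := by
      rw [norm_smul]; norm_num; ring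
    rw [hn, ha]
    set β := ‖b‖
    have hβ : 0 ≤ β := norm_nonneg _
    have h1 : ‖a + b‖ ≤ 1 + β := by rw [← ha]; exact norm_add_le _ _
    have h1' : ‖a - b‖ ≤ 1 + β := by rw [← ha]; exact norm_sub_le _ _
    have h2 : 0 ≤ ‖a + b‖ := norm_nonneg _
    have h3 : 0 ≤ ‖a - b‖ := norm_nonneg _
    have hD : (1 - β) ^ 2 / 4 ≤ (1 ^ 2 + β ^ 2) / 2 - (‖a + b‖ / 2) ^ 2 := by nlinarith
    rcases le_or_gt (Real.sqrt ε) ‖a - b‖ with hc | hc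
    · have h4 : ‖a + b‖ ≤ 2 - δ := (h₀ ha.le hb hc).trans (by linarith)
      have hD2 : δ ^ 2 / 64 ≤ (1 ^ 2 + β ^ 2) / 2 - (‖a + b‖ / 2) ^ 2 := by
        rcases le_or_gt (δ / 4) (1 - β) with h5 | h5
        · refine le_trans ?_ hD
          nlinarith
        · have : (‖a + b‖ / 2) ^ 2 ≤ (1 - δ / 2) ^ 2 := by
            apply pow_le_pow_left₀ (by positivity); linarith
          nlinarith
      have h6 : ‖a - b‖ ^ 2 ≤ 4 := by nlinarith
      have h7 : 256 / δ ^ 2 * (δ ^ 2 / 64) = 4 := by field_simp; norm_num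
      have h8 := mul_le_mul_of_nonneg_left hD2 (by positivity : 0 ≤ 256 / δ ^ 2)
      have h9 : 0 ≤ ε * (1 ^ 2 + β ^ 2) := by positivity
      linarith
    · have h4 : ‖a - b‖ ^ 2 ≤ ε := by
        rw [← Real.sq_sqrt hε.le]; exact pow_le_pow_left₀ h3 hc.le 2
      have h5 : 0 ≤ 256 / δ ^ 2 * ((1 ^ 2 + β ^ 2) / 2 - (‖a + b‖ / 2) ^ 2) :=
        mul_nonneg (by positivity) (le_trans (by positivity) hD)
      nlinarith [mul_nonneg hε.le (sq_nonneg β)]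
  -- ordered version
  have key2 : ∀ a b : E, ‖b‖ ≤ ‖a‖ →
      ‖a - b‖ ^ 2 ≤ ε * (‖a‖ ^ 2 + ‖b‖ ^ 2) +
      256 / δ ^ 2 * ((‖a‖ ^ 2 + ‖b‖ ^ 2) / 2 - ‖(1 / 2 : ℝ) • (a + b)‖ ^ 2) := by
    intro a b hab
    rcases eq_or_ne a 0 with rfl | ha
    · have : b = 0 := by simpa using hab
      subst this; simp
    have hm : 0 < ‖a‖ := norm_pos_iff.2 ha
    have hs : ∀ z : E, ‖‖a‖⁻¹ • z‖ = ‖a‖⁻¹ * ‖z‖ := fun z => by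
      rw [norm_smul, norm_inv, norm_norm]
    have := key (‖a‖⁻¹ • a) (‖a‖⁻¹ • b) (by rw [hs, inv_mul_cancel₀ hm.ne'])
      (by rw [hs, inv_mul_le_iff₀ hm]; simpa using hab)
    rw [← smul_sub, ← smul_add, smul_comm, hs, hs, hs, hs] at this
    have h2 := mul_le_mul_of_nonneg_left this (sq_nonneg ‖a‖)
    have e : ∀ t : ℝ, ‖a‖ ^ 2 * (‖a‖⁻¹ * t) ^ 2 = t ^ 2 := fun t => by field_simp
    calc ‖a - b‖ ^ 2 = ‖a‖ ^ 2 * (‖a‖⁻¹ * ‖a - b‖) ^ 2 := (e _).symm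
      _ ≤ _ := h2
      _ = ε * (‖a‖ ^ 2 * (‖a‖⁻¹ * ‖a‖) ^ 2 + ‖a‖ ^ 2 * (‖a‖⁻¹ * ‖b‖) ^ 2) +
          256 / δ ^ 2 * ((‖a‖ ^ 2 * (‖a‖⁻¹ * ‖a‖) ^ 2 + ‖a‖ ^ 2 * (‖a‖⁻¹ * ‖b‖) ^ 2) / 2
            - ‖a‖ ^ 2 * (‖a‖⁻¹ * ‖(1 / 2 : ℝ) • (a + b)‖) ^ 2) := by ring
      _ = _ := by simp only [e]
  refine ⟨256 / δ ^ 2, by positivity, fun a b => ?_⟩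
  rcases le_total ‖b‖ ‖a‖ with h | h
  · exact key2 a b h
  · have := key2 b a h
    rwa [norm_sub_rev, add_comm b a, add_comm (‖b‖ ^ 2)] at this

lemma lp_norm_sq {Ω : Type*} [MeasurableSpace Ω] {P : Measure Ω}
    {B : Type*} [NormedAddCommGroup B] (f : Lp B 2 P) :
    ‖f‖ ^ 2 = ∫ ω, ‖f ω‖ ^ 2 ∂P := by
  have h := (Lp.memLp f).eLpNorm_eq_integral_rpow_norm (by norm_num) (by norm_num)
  rw [Lp.norm_def, h, ENNReal.toReal_ofReal (by positivity)]
  simp only [ENNReal.toReal_ofNat, Real.rpow_ofNat]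
  rw [← Real.rpow_natCast, ← Real.rpow_mul (by positivity)]
  norm_num

lemma ucsq_lp {Ω : Type*} [MeasurableSpace Ω] {P : Measure Ω}
    {B : Type*} [NormedAddCommGroup B] [NormedSpace ℝ B] (hB : UCsq B) :
    UCsq (Lp B 2 P) := by
  intro ε hε
  obtain ⟨C, hC, h⟩ := hB ε hε
  refine ⟨C, hC, fun a b => ?_⟩
  have hi : ∀ f : Lp B 2 P, Integrable (fun ω => ‖f ω‖ ^ 2) P := fun f =>
    (Lp.memLp f).integrable_norm_pow (by norm_num)
  simp only [lp_norm_sq]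
  have i1 : Integrable (fun ω => ‖a ω‖ ^ 2 + ‖b ω‖ ^ 2) P := (hi a).add (hi b)
  have i2 := hi ((1 / 2 : ℝ) • (a + b))
  have i3 : Integrable (fun ω => C * ((‖a ω‖ ^ 2 + ‖b ω‖ ^ 2) / 2 -
      ‖((1 / 2 : ℝ) • (a + b) : Lp B 2 P) ω‖ ^ 2)) P := ((i1.div_const 2).sub i2).const_mul C
  rw [← integral_add (hi a) (hi b), ← integral_const_mul, ← integral_div,
    ← integral_sub (i1.div_const 2) i2, ← integral_const_mul, ← integral_add (i1.const_mul ε) i3]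
  refine integral_mono_ae (hi _) ((i1.const_mul ε).add i3) ?_
  filter_upwards [Lp.coeFn_sub a b, Lp.coeFn_smul (1 / 2 : ℝ) (a + b), Lp.coeFn_add a b]
    with ω h1 h2 h3
  rw [h1, h2, Pi.smul_apply, h3]
  exact h _ _

lemma abstract_fixed {X E : Type*} [NormedAddCommGroup E] [NormedSpace ℝ E] [CompleteSpace E]
    (hE : UCsq E) [Nonempty X] (J : X → E) (hinj : Injective J) (K : ℝ) (hK : ∀ x, ‖J x‖ ≤ K)
    (hmid : ∀ x y, ∃ z, J z = (1 / 2 : ℝ) • (J x + J y))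
    (hcl : ∀ (x : ℕ → X) (e : E), Tendsto (fun n => J (x n)) atTop (nhds e) → ∃ y, J y = e)
    (𝒯 : Set (Function.End X)) (hne : ∀ T ∈ 𝒯, ∀ x y, ‖J (T x) - J (T y)‖ ≤ ‖J x - J y‖)
    (hcomm : ∀ T ∈ 𝒯, ∀ S ∈ 𝒯, T * S = S * T) :
    ∃ x, ∀ T ∈ 𝒯, T x = x := by
  set M := Submonoid.closure 𝒯 with hM
  have hMc : ∀ s ∈ M, ∀ t ∈ M, s * t = t * s := fun s hs t ht => by
    have := Submonoid.closure_le_centralizer_centralizer 𝒯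
    exact Set.centralizer_centralizer_comm_of_comm hcomm _ (this hs) _ (this ht)
  obtain ⟨x0⟩ := ‹Nonempty X›
  -- asymptotic radius
  let A : X → Set ℝ := fun y => {c | ∃ s ∈ M, ∀ t ∈ M, ‖J y - J ((t * s) x0)‖ ^ 2 ≤ c}
  let r : X → ℝ := fun y => sInf (A y)
  have hA0 : ∀ y, ∀ c ∈ A y, 0 ≤ c := by
    rintro y c ⟨s, hs, h⟩
    exact (sq_nonneg _).trans (h 1 (one_mem _))
  have hAbd : ∀ y, BddBelow (A y) := fun y => ⟨0, hA0 y⟩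
  have hAne : ∀ y, (A y).Nonempty := fun y => ⟨(K + K) ^ 2, 1, one_mem _, fun t _ => by
    apply pow_le_pow_left₀ (norm_nonneg _)
    exact (norm_sub_le _ _).trans (add_le_add (hK _) (hK _))⟩
  have hr0 : ∀ y, 0 ≤ r y := fun y => le_csInf (hAne y) (hA0 y)
  have hup : ∀ y, ∀ η > 0, ∃ s ∈ M, ∀ t ∈ M, ‖J y - J ((t * s) x0)‖ ^ 2 ≤ r y + η := by
    intro y η hη
    obtain ⟨c, ⟨s, hs, h⟩, hc⟩ := exists_lt_of_csInf_lt (hAne y) (lt_add_of_pos_right (r y) hη)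
    exact ⟨s, hs, fun t ht => (h t ht).trans hc.le⟩
  have hlow : ∀ y, ∀ η > 0, ∀ s ∈ M, ∃ t ∈ M, r y - η ≤ ‖J y - J ((t * s) x0)‖ ^ 2 := by
    intro y η hη s hs
    by_contra! hcon
    have : r y ≤ r y - η := csInf_le (hAbd y) ⟨s, hs, fun t ht => (hcon t ht).le⟩
    linarith
  have hrT : ∀ T ∈ 𝒯, ∀ y, r (T y) ≤ r y := by
    intro T hT y
    refine le_csInf (hAne y) ?_
    rintro c ⟨s, hs, h⟩
    have hTM : T ∈ M := Submonoid.subset_closure hT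
    refine csInf_le (hAbd _) ⟨T * s, mul_mem hTM hs, fun t ht => ?_⟩
    have e : t * (T * s) = T * (t * s) := by
      rw [← mul_assoc, hMc t ht T hTM, mul_assoc]
    rw [e]
    exact (pow_le_pow_left₀ (norm_nonneg _) (hne T hT y ((t * s) x0)) 2).trans (h t ht)
  let r0 : ℝ := sInf (range r)
  have hrbd : BddBelow (range r) := ⟨0, by rintro _ ⟨y, rfl⟩; exact hr0 y⟩
  have hr0le : ∀ y, r0 ≤ r y := fun y => csInf_le hrbd ⟨y, rfl⟩
  have hr0n : 0 ≤ r0 := le_csInf ⟨_, x0, rfl⟩ (by rintro _ ⟨y, rfl⟩; exact hr0 y)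
  have main : ∀ ε > 0, ∃ δ > 0, ∀ y z, r y ≤ r0 + δ → r z ≤ r0 + δ → ‖J y - J z‖ < ε := by
    intro ε hε
    have hε2 : 0 < ε ^ 2 := by positivity
    obtain ⟨C, hC, h⟩ := hE (ε ^ 2 / (8 * (r0 + 2))) (by positivity)
    set ε' := ε ^ 2 / (8 * (r0 + 2)) with hε'
    have hε'p : 0 < ε' := by positivity
    have hεe : ε' * (2 * (r0 + 2)) = ε ^ 2 / 4 := by rw [hε']; field_simp; norm_num
    obtain ⟨δ, hδ, hδ1, hδC⟩ : ∃ δ : ℝ, 0 < δ ∧ δ ≤ 1 ∧ C * (3 * δ) ≤ ε ^ 2 / 4 := by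
      refine ⟨min 1 (ε ^ 2 / (12 * C)), lt_min one_pos (by positivity), min_le_left _ _, ?_⟩
      have := mul_le_mul_of_nonneg_left (min_le_right 1 (ε ^ 2 / (12 * C)))
        (by positivity : 0 ≤ C * 3)
      calc _ = C * 3 * min 1 (ε ^ 2 / (12 * C)) := by ring
        _ ≤ _ := this
        _ = _ := by field_simp; norm_num
    refine ⟨δ, hδ, fun y z hy hz => ?_⟩
    obtain ⟨m, hm⟩ := hmid y z
    obtain ⟨s, hs, h1⟩ := hup y δ hδ
    obtain ⟨s', hs', h2⟩ := hup z δ hδ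
    obtain ⟨t, ht, h3⟩ := hlow m δ hδ (s * s') (mul_mem hs hs')
    have h1' := h1 (t * s') (mul_mem ht hs')
    have h2' := h2 (t * s) (mul_mem ht hs)
    rw [mul_assoc, ← hMc s hs s' hs'] at h1'
    rw [mul_assoc] at h2'
    set u := J ((t * (s * s')) x0)
    have h4 := h (J y - u) (J z - u)
    have e1 : J y - u - (J z - u) = J y - J z := by abel
    have e2 : (1 / 2 : ℝ) • (J y - u + (J z - u)) = J m - u := by
      rw [hm]; module
    rw [e1, e2] at h4
    have hrm := hr0le m
    have b1 : ‖J y - u‖ ^ 2 + ‖J z - u‖ ^ 2 ≤ 2 * (r0 + 2) := by linarith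
    have b2 : (‖J y - u‖ ^ 2 + ‖J z - u‖ ^ 2) / 2 - ‖J m - u‖ ^ 2 ≤ 3 * δ := by linarith
    have b3 := mul_le_mul_of_nonneg_left b1 hε'p.le
    have b4 := mul_le_mul_of_nonneg_left b2 hC.le
    have : ‖J y - J z‖ ^ 2 < ε ^ 2 := by linarith
    exact lt_of_pow_lt_pow_left₀ 2 hε.le this
  have hseq : ∀ n : ℕ, ∃ y, r y < r0 + 1 / ((n : ℝ) + 1) := fun n => by
    obtain ⟨_, ⟨y, rfl⟩, hy⟩ := exists_lt_of_csInf_lt (⟨_, x0, rfl⟩ : (range r).Nonempty)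
      (lt_add_of_pos_right r0 (Nat.one_div_pos_of_nat (n := n)))
    exact ⟨y, hy⟩
  choose y hy using hseq
  have hev : ∀ δ > 0, ∃ N : ℕ, ∀ n ≥ N, r (y n) ≤ r0 + δ := by
    intro δ hδ
    obtain ⟨N, hN⟩ := exists_nat_one_div_lt hδ
    refine ⟨N, fun n hn => (hy n).le.trans ?_⟩
    have := Nat.one_div_le_one_div (α := ℝ) hn
    linarith
  have hcau : CauchySeq (fun n => J (y n)) := by
    rw [Metric.cauchySeq_iff]
    intro ε hε
    obtain ⟨δ, hδ, h⟩ := main ε hε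
    obtain ⟨N, hN⟩ := hev δ hδ
    exact ⟨N, fun m hm n hn => by rw [dist_eq_norm]; exact h _ _ (hN m hm) (hN n hn)⟩
  obtain ⟨e, he⟩ := cauchySeq_tendsto_of_complete hcau
  obtain ⟨x, rfl⟩ := hcl y e he
  refine ⟨x, fun T hT => hinj ?_⟩
  have t1 : Tendsto (fun n => J (T (y n))) atTop (nhds (J (T x))) := by
    rw [tendsto_iff_norm_sub_tendsto_zero] at he ⊢
    exact squeeze_zero (fun _ => norm_nonneg _) (fun n => hne T hT _ _) he
  have t2 : Tendsto (fun n => J (T (y n)) - J (y n)) atTop (nhds 0) := by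
    rw [Metric.tendsto_atTop]
    intro ε hε
    obtain ⟨δ, hδ, h⟩ := main ε hε
    obtain ⟨N, hN⟩ := hev δ hδ
    refine ⟨N, fun n hn => ?_⟩
    rw [dist_zero_right]
    exact h _ _ ((hrT T hT _).trans (hN n hn)) (hN n hn)
  have := tendsto_nhds_unique (t1.sub he) t2
  exact sub_eq_zero.1 this

/-- If `B` is a uniformly convex Banach space and `G` a nonempty a.s. bounded closed
`L⁰`-convex subset of `L⁰(𝓕,B)`, then every commutative family of nonexpansive
self-mappings of `G` has a common fixed point. -/
theorem common_fixed_point_of_commutative_nonexpansive_uniformConvex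
    {Ω : Type*} [MeasurableSpace Ω] {P : Measure Ω} [IsProbabilityMeasure P]
    {B : Type*} [NormedAddCommGroup B] [NormedSpace ℝ B] [CompleteSpace B]
    [UniformConvexSpace B]
    (G : Set (Ω →ₘ[P] B)) (hGne : G.Nonempty) (hGbd : ASBounded G)
    (hGcl : SeqClosed G) (hGcv : LConvex G)
    (𝒯 : Set ((Ω →ₘ[P] B) → (Ω →ₘ[P] B)))
    (hmaps : ∀ T ∈ 𝒯, Set.MapsTo T G G)
    (hnonexp : ∀ T ∈ 𝒯, NonexpansiveOn G T)
    (hcomm : ∀ T ∈ 𝒯, ∀ S ∈ 𝒯, ∀ x ∈ G, T (S x) = S (T x)) :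
    ∃ x ∈ G, ∀ T ∈ 𝒯, T x = x := by
  obtain ⟨ξ, hξ⟩ := hGbd
  -- the weight
  let v : Ω → ℝ := fun ω => 1 + |ξ ω|
  have hv : ∀ ω, 0 < v ω := fun ω => by positivity
  have hvm : AEStronglyMeasurable v P :=
    aestronglyMeasurable_const.add ξ.aestronglyMeasurable.norm
  have hvi : AEStronglyMeasurable (fun ω => (v ω)⁻¹) P := hvm.aemeasurable.inv.aestronglyMeasurable
  have hnrm : ∀ x : Ω →ₘ[P] B, ∀ᵐ ω ∂P, nrm x ω = ‖x ω‖ := fun x =>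
    AEEqFun.coeFn_comp norm continuous_norm x
  have hbd : ∀ x : G, ∀ᵐ ω ∂P, ‖(v ω)⁻¹ • (x : Ω →ₘ[P] B) ω‖ ≤ 1 := by
    intro x
    filter_upwards [hnrm x, AEEqFun.coeFn_le.2 (hξ x x.2)] with ω h1 h2
    rw [norm_smul, norm_inv, Real.norm_of_nonneg (hv ω).le, inv_mul_le_iff₀ (hv ω), mul_one, ← h1]
    exact h2.trans ((le_abs_self _).trans (by simp [v]))
  have hmem : ∀ x : G, MemLp (fun ω => (v ω)⁻¹ • (x : Ω →ₘ[P] B) ω) 2 P := fun x =>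
    MemLp.of_bound (hvi.smul (x : Ω →ₘ[P] B).aestronglyMeasurable) 1 (hbd x)
  let J : G → Lp B 2 P := fun x => (hmem x).toLp _
  have hJ : ∀ x : G, ∀ᵐ ω ∂P, J x ω = (v ω)⁻¹ • (x : Ω →ₘ[P] B) ω := fun x =>
    (hmem x).coeFn_toLp
  have hinj : Injective J := by
    intro x y hxy
    apply Subtype.ext
    apply AEEqFun.ext
    filter_upwards [hJ x, hJ y] with ω h1 h2
    rw [hxy, h2] at h1
    exact (smul_right_injective B (inv_ne_zero (hv ω).ne') h1).symm
  have hK : ∀ x, ‖J x‖ ≤ (measureUnivNNReal P : ℝ) ^ (2 : ℝ)⁻¹ := by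
    intro x
    have h := Lp.norm_le_of_ae_bound (f := J x) zero_le_one (by
      filter_upwards [hJ x, hbd x] with ω h1 h2
      rw [h1]; exact h2)
    simpa using h
  have hmid : ∀ x y, ∃ z, J z = (1 / 2 : ℝ) • (J x + J y) := by
    intro x y
    let l : Ω →ₘ[P] ℝ := AEEqFun.const Ω (1 / 2 : ℝ)
    have hl : ∀ᵐ ω ∂P, l ω = 1 / 2 := AEEqFun.coeFn_const Ω (1 / 2 : ℝ)
    have hl0 : 0 ≤ l := by
      rw [← AEEqFun.coeFn_le]
      filter_upwards [hl, AEEqFun.coeFn_zero (α := Ω) (μ := P) (β := ℝ)] with ω h1 h2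
      rw [h1, h2]; norm_num
    have hl1 : l ≤ 1 := by
      rw [← AEEqFun.coeFn_le]
      filter_upwards [hl, AEEqFun.coeFn_one (α := Ω) (μ := P) (β := ℝ)] with ω h1 h2
      rw [h1, h2]; norm_num
    refine ⟨⟨_, hGcv x x.2 y y.2 l hl0 hl1⟩, ?_⟩
    apply Lp.ext
    filter_upwards [hJ ⟨_, hGcv x x.2 y y.2 l hl0 hl1⟩, hJ x, hJ y,
      Lp.coeFn_smul (1 / 2 : ℝ) (J x + J y), Lp.coeFn_add (J x) (J y), hl,
      AEEqFun.coeFn_one (α := Ω) (μ := P) (β := ℝ), AEEqFun.coeFn_sub (1 : Ω →ₘ[P] ℝ) l,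
      AEEqFun.coeFn_add (msmul l (x : Ω →ₘ[P] B)) (msmul (1 - l) (y : Ω →ₘ[P] B)),
      AEEqFun.coeFn_comp₂ (fun c (b : B) => c • b) continuous_smul l (x : Ω →ₘ[P] B),
      AEEqFun.coeFn_comp₂ (fun c (b : B) => c • b) continuous_smul (1 - l) (y : Ω →ₘ[P] B)]
      with ω h1 h2 h3 h4 h5 h6 h7 h8 h9 h10 h11
    have h10' : msmul l (x : Ω →ₘ[P] B) ω = l ω • (x : Ω →ₘ[P] B) ω := h10
    have h11' : msmul (1 - l) (y : Ω →ₘ[P] B) ω = (1 - l) ω • (y : Ω →ₘ[P] B) ω := h11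
    rw [h1, h4, Pi.smul_apply, h5, Pi.add_apply, h2, h3, h9, Pi.add_apply, h10', h11', h8,
      Pi.sub_apply, h7, h6, Pi.one_apply]
    module
  have hcl : ∀ (x : ℕ → G) (e : Lp B 2 P), Tendsto (fun n => J (x n)) atTop (nhds e) →
      ∃ y, J y = e := by
    intro x e he
    obtain ⟨ns, -, hns⟩ := (tendstoInMeasure_of_tendsto_Lp he).exists_seq_tendsto_ae
    have hem : AEStronglyMeasurable (fun ω => v ω • e ω) P :=
      hvm.smul (Lp.aestronglyMeasurable e)
    have hcoe := AEEqFun.coeFn_mk _ hem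
    have hyG : AEEqFun.mk _ hem ∈ G := by
      refine hGcl (fun n => (x (ns n) : Ω →ₘ[P] B)) _ (fun n => (x (ns n)).2) ?_
      refine tendstoInMeasure_of_tendsto_ae (fun n => AEEqFun.aestronglyMeasurable _) ?_
      filter_upwards [hns, hcoe, ae_all_iff.2 fun n => hJ (x (ns n))] with ω h1 h2 h3
      rw [h2]
      refine (h1.const_smul (v ω)).congr fun n => ?_
      rw [h3, smul_inv_smul₀ (hv ω).ne']
    refine ⟨⟨_, hyG⟩, Lp.ext ?_⟩
    filter_upwards [hJ ⟨_, hyG⟩, hcoe] with ω h1 h2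
    rw [h1]
    change (v ω)⁻¹ • (AEEqFun.mk _ hem) ω = _
    rw [h2, inv_smul_smul₀ (hv ω).ne']
  have : Nonempty G := hGne.to_subtype
  let 𝒮 : Set (Function.End G) := {S | ∃ T ∈ 𝒯, ∀ x : G, (S x : Ω →ₘ[P] B) = T x}
  have hne : ∀ S ∈ 𝒮, ∀ x y, ‖J (S x) - J (S y)‖ ≤ ‖J x - J y‖ := by
    rintro S ⟨T, hT, hS⟩ x y
    apply Lp.norm_le_norm_of_ae_le
    filter_upwards [Lp.coeFn_sub (J (S x)) (J (S y)), Lp.coeFn_sub (J x) (J y), hJ x, hJ y,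
      hJ (S x), hJ (S y), AEEqFun.coeFn_le.2 (hnonexp T hT x x.2 y y.2), hnrm (T x - T y),
      hnrm ((x : Ω →ₘ[P] B) - y), AEEqFun.coeFn_sub (T x) (T y),
      AEEqFun.coeFn_sub (x : Ω →ₘ[P] B) y] with ω h1 h2 h3 h4 h5 h6 h7 h8 h9 h10 h11
    rw [h1, h2, Pi.sub_apply, Pi.sub_apply, h3, h4, h5, h6, hS, hS, ← smul_sub, ← smul_sub,
      norm_smul, norm_smul]
    rw [h8, h9, h10, h11] at h7
    exact mul_le_mul_of_nonneg_left h7 (norm_nonneg _)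
  have hcm : ∀ T ∈ 𝒮, ∀ S ∈ 𝒮, T * S = S * T := by
    rintro S ⟨T, hT, hS⟩ S' ⟨T', hT', hS'⟩
    funext x
    apply Subtype.ext
    change ((S (S' x) : G) : Ω →ₘ[P] B) = (S' (S x) : G)
    rw [hS, hS', hS', hS]
    exact hcomm T hT T' hT' x x.2
  obtain ⟨x, hx⟩ := abstract_fixed (ucsq_lp (ucsq_of_uniformConvex B)) J hinj _ hK hmid hcl 𝒮
    hne hcm
  refine ⟨x, x.2, fun T hT => ?_⟩
  have := hx (fun z : G => ⟨T z, hmaps T hT z.2⟩) ⟨T, hT, fun _ => rfl⟩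
  exact congrArg Subtype.val this

end RNM
end
end

section
/- Let B be a uniformly convex real Banach space and G a nonempty a.s. bounded closed L⁰-convex subset of L⁰(𝓕,B). Then every isometric mapping T : G → G has a fixed point belonging to the random Chebyshev center C(G,G). -/
open MeasureTheory Set Filter Function
open scoped Classical

noncomputable section

namespace RNM


variable {Ω : Type*} [MeasurableSpace Ω] {P : Measure Ω}
variable {B : Type*} [NormedAddCommGroup B] [NormedSpace ℝ B]

theorem nrm_sub_le_iff (x y : Ω →ₘ[P] B) (c : Ω →ₘ[P] ℝ) :
    nrm (x - y) ≤ c ↔ ∀ᵐ ω ∂P, ‖x ω - y ω‖ ≤ c ω := by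
  rw [← AEEqFun.coeFn_le]
  have h1 := AEEqFun.coeFn_comp norm continuous_norm (x - y)
  have h2 := AEEqFun.coeFn_sub x y
  constructor
  · intro h
    filter_upwards [h1, h2, h] with ω h1 h2 h
    have h' : (AEEqFun.comp norm continuous_norm (x - y)) ω ≤ c ω := h
    rw [h1] at h'
    simpa [h2] using h'
  · intro h
    filter_upwards [h1, h2, h] with ω h1 h2 h
    change (AEEqFun.comp norm continuous_norm (x - y)) ω ≤ c ω
    rw [h1]
    simpa [h2] using h

theorem nrm_sub_ae (x y : Ω →ₘ[P] B) :
    ∀ᵐ ω ∂P, nrm (x - y) ω = ‖x ω - y ω‖ := by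
  filter_upwards [AEEqFun.coeFn_comp norm continuous_norm (x - y), AEEqFun.coeFn_sub x y]
    with ω h1 h2
  change (AEEqFun.comp norm continuous_norm (x - y)) ω = _
  rw [h1]
  simp [h2]

theorem combo_ae (l : Ω →ₘ[P] ℝ) (x y : Ω →ₘ[P] B) :
    ∀ᵐ ω ∂P, (msmul l x + msmul (1 - l) y) ω = l ω • x ω + (1 - l ω) • y ω := by
  filter_upwards [AEEqFun.coeFn_add (msmul l x) (msmul (1 - l) y),
    AEEqFun.coeFn_comp₂ (fun c (b : B) => c • b) continuous_smul l x,
    AEEqFun.coeFn_comp₂ (fun c (b : B) => c • b) continuous_smul (1 - l) y,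
    AEEqFun.coeFn_sub (1 : Ω →ₘ[P] ℝ) l, AEEqFun.coeFn_one (α := Ω) (μ := P) (β := ℝ)]
    with ω h1 h2 h3 h4 h5
  have h2' : msmul l x ω = l ω • x ω := h2
  have h3' : msmul (1 - l) y ω = (1 - l : Ω →ₘ[P] ℝ) ω • y ω := h3
  rw [h1, Pi.add_apply, h2', h3', h4, Pi.sub_apply, h5, Pi.one_apply]

/-- A set of random variables closed under minima and bounded below has an essential infimum,
attained along a sequence. -/
theorem exists_glb_seq [IsProbabilityMeasure P] (S : Set (Ω →ₘ[P] ℝ)) (hne : S.Nonempty)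
    (b : Ω →ₘ[P] ℝ) (hb : ∀ c ∈ S, b ≤ c) (hinf : ∀ a ∈ S, ∀ c ∈ S, a ⊓ c ∈ S) :
    ∃ d : Ω →ₘ[P] ℝ, IsGLB S d ∧ ∃ c : ℕ → Ω →ₘ[P] ℝ, (∀ n, c n ∈ S) ∧
      ∀ᵐ ω ∂P, Tendsto (fun n => c n ω) atTop (nhds (d ω)) := by
  have hint : ∀ c : Ω →ₘ[P] ℝ, Integrable (fun ω => Real.arctan (c ω)) P := by
    intro c
    refine Integrable.of_bound (C := Real.pi / 2)
      (Real.continuous_arctan.comp_aestronglyMeasurable c.aestronglyMeasurable) ?_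
    refine Eventually.of_forall fun ω => ?_
    rw [Real.norm_eq_abs, abs_le]
    exact ⟨(Real.neg_pi_div_two_lt_arctan _).le, (Real.arctan_lt_pi_div_two _).le⟩
  set φ : (Ω →ₘ[P] ℝ) → ℝ := fun c => ∫ ω, Real.arctan (c ω) ∂P with hφ
  have hmono : ∀ a c : Ω →ₘ[P] ℝ, a ≤ c → φ a ≤ φ c := by
    intro a c h
    refine integral_mono_ae (hint a) (hint c) ?_
    filter_upwards [AEEqFun.coeFn_le.2 h] with ω h
    exact Real.arctan_mono h
  have hbdd : BddBelow (φ '' S) := ⟨φ b, by rintro _ ⟨c, hc, rfl⟩; exact hmono _ _ (hb c hc)⟩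
  set I := sInf (φ '' S) with hI
  have hle : ∀ c ∈ S, I ≤ φ c := fun c hc => csInf_le hbdd ⟨c, hc, rfl⟩
  have hex : ∀ n : ℕ, ∃ a ∈ S, φ a < I + 1 / ((n : ℝ) + 1) := by
    intro n
    obtain ⟨_, ⟨a, ha, rfl⟩, h⟩ := exists_lt_of_csInf_lt (hne.image φ)
      (show sInf (φ '' S) < I + 1 / ((n : ℝ) + 1) from lt_add_of_pos_right _ (by positivity))
    exact ⟨a, ha, h⟩
  choose a haS ha using hex
  let c : ℕ → Ω →ₘ[P] ℝ := fun n => Nat.rec (a 0) (fun k r => r ⊓ a (k + 1)) n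
  have hc0 : c 0 = a 0 := rfl
  have hcs : ∀ n, c (n + 1) = c n ⊓ a (n + 1) := fun n => rfl
  have hcS : ∀ n, c n ∈ S := by
    intro n
    induction n with
    | zero => exact haS 0
    | succ k ih => rw [hcs]; exact hinf _ ih _ (haS _)
  have hca : ∀ n, c n ≤ a n := by
    intro n
    cases n with
    | zero => exact le_rfl
    | succ k => rw [hcs]; exact inf_le_right
  have hanti : ∀ᵐ ω ∂P, ∀ n, c (n + 1) ω ≤ c n ω := by
    rw [ae_all_iff]
    intro n
    exact AEEqFun.coeFn_le.2 (by rw [hcs]; exact inf_le_left)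
  have hlow : ∀ᵐ ω ∂P, ∀ n, b ω ≤ c n ω := by
    rw [ae_all_iff]
    intro n
    exact AEEqFun.coeFn_le.2 (hb _ (hcS n))
  obtain ⟨f, hf, hlim⟩ := exists_stronglyMeasurable_limit_of_tendsto_ae (μ := P)
    (f := fun n => (c n : Ω → ℝ)) (fun n => (c n).aestronglyMeasurable) (by
      filter_upwards [hanti, hlow] with ω h1 h2
      refine ⟨_, tendsto_atTop_ciInf (antitone_nat_of_succ_le h1) ⟨b ω, ?_⟩⟩
      rintro _ ⟨n, rfl⟩
      exact h2 n)
  set d : Ω →ₘ[P] ℝ := AEEqFun.mk f hf.aestronglyMeasurable with hd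
  have hdf : d =ᵐ[P] f := AEEqFun.coeFn_mk _ _
  have hlimd : ∀ᵐ ω ∂P, Tendsto (fun n => c n ω) atTop (nhds (d ω)) := by
    filter_upwards [hlim, hdf] with ω h1 h2
    rw [h2]; exact h1
  have hDCT : ∀ (g : ℕ → Ω →ₘ[P] ℝ) (e : Ω →ₘ[P] ℝ),
      (∀ᵐ ω ∂P, Tendsto (fun n => g n ω) atTop (nhds (e ω))) →
      Tendsto (fun n => φ (g n)) atTop (nhds (φ e)) := by
    intro g e h
    refine tendsto_integral_of_dominated_convergence (fun _ => Real.pi / 2)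
      (fun n => (hint (g n)).aestronglyMeasurable) (integrable_const _) ?_ ?_
    · intro n
      refine Eventually.of_forall fun ω => ?_
      rw [Real.norm_eq_abs, abs_le]
      exact ⟨(Real.neg_pi_div_two_lt_arctan _).le, (Real.arctan_lt_pi_div_two _).le⟩
    · filter_upwards [h] with ω h
      exact (Real.continuous_arctan.tendsto _).comp h
  have hφd : φ d ≤ I := by
    have h1 := hDCT c d hlimd
    have h2 : Tendsto (fun n : ℕ => I + 1 / ((n : ℝ) + 1)) atTop (nhds (I + 0)) :=
      tendsto_const_nhds.add tendsto_one_div_add_atTop_nhds_zero_nat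
    rw [add_zero] at h2
    exact le_of_tendsto_of_tendsto' h1 h2 fun n => (hmono _ _ (hca n)).trans (ha n).le
  refine ⟨d, ⟨?_, ?_⟩, c, hcS, hlimd⟩
  · intro e he
    have hmin : ∀ᵐ ω ∂P, Tendsto (fun n => (c n ⊓ e) ω) atTop (nhds ((d ⊓ e) ω)) := by
      have hall : ∀ᵐ ω ∂P, ∀ n, (c n ⊓ e) ω = c n ω ⊓ e ω := by
        rw [ae_all_iff]
        exact fun n => AEEqFun.coeFn_inf _ _
      filter_upwards [hall, AEEqFun.coeFn_inf d e, hlimd] with ω h1 h2 h3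
      rw [h2]
      simp only [h1]
      exact h3.min tendsto_const_nhds
    have h1 : I ≤ φ (d ⊓ e) :=
      ge_of_tendsto' (hDCT _ _ hmin) fun n => hle _ (hinf _ (hcS n) _ he)
    have h2 : ∀ᵐ ω ∂P, (d ⊓ e) ω ≤ d ω := AEEqFun.coeFn_le.2 inf_le_left
    have h3 : ∫ ω, (Real.arctan (d ω) - Real.arctan ((d ⊓ e) ω)) ∂P = 0 := by
      apply le_antisymm
      · rw [integral_sub (hint _) (hint _)]
        have : φ d ≤ φ (d ⊓ e) := hφd.trans h1
        simp only [hφ] at this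
        linarith
      · apply integral_nonneg_of_ae
        filter_upwards [h2] with ω h
        exact sub_nonneg.2 (Real.arctan_mono h)
    have h3' := (integral_eq_zero_iff_of_nonneg_ae
      (f := fun ω => Real.arctan (d ω) - Real.arctan ((d ⊓ e) ω)) (by
        filter_upwards [h2] with ω h
        exact sub_nonneg.2 (Real.arctan_mono h)) ((hint _).sub (hint _))).1 h3
    rw [← AEEqFun.coeFn_le]
    filter_upwards [h3', AEEqFun.coeFn_inf d e] with ω h3 h4
    have h5 : d ω = (d ⊓ e) ω := Real.arctan_injective (sub_eq_zero.1 h3)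
    rw [h5, h4]
    exact inf_le_right
  · intro e he
    rw [← AEEqFun.coeFn_le]
    have hall : ∀ᵐ ω ∂P, ∀ n, e ω ≤ c n ω := by
      rw [ae_all_iff]
      exact fun n => AEEqFun.coeFn_le.2 (he (hcS n))
    filter_upwards [hall, hlimd] with ω h1 h2
    exact ge_of_tendsto' h2 h1

theorem exists_lub [IsProbabilityMeasure P] (S : Set (Ω →ₘ[P] ℝ)) (hne : S.Nonempty)
    (hb : BddAbove S) : ∃ d, IsLUB S d := by
  obtain ⟨b, hbS⟩ := hne
  obtain ⟨d, hd, -⟩ := exists_glb_seq (upperBounds S) hb b (fun c hc => hc hbS)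
    (fun a ha c hc s hs => le_inf (ha hs) (hc hs))
  exact ⟨d, isGLB_upperBounds.1 hd⟩

theorem lsup_isLUB (S : Set (Ω →ₘ[P] ℝ)) (h : ∃ ξ, IsLUB S ξ) : IsLUB S (lsup S) := by
  unfold lsup
  rw [dif_pos h]
  exact h.choose_spec

theorem linf_eq (S : Set (Ω →ₘ[P] ℝ)) (d : Ω →ₘ[P] ℝ) (h : IsGLB S d) : linf S = d := by
  have h' : ∃ ξ, IsGLB S ξ := ⟨d, h⟩
  unfold linf
  rw [dif_pos h']
  exact h'.choose_spec.unique h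

/-- Scaled uniform convexity. -/
theorem uc_scaled (B : Type*) [NormedAddCommGroup B] [NormedSpace ℝ B] [UniformConvexSpace B]
    (ε : ℝ) (hε : 0 < ε) :
    ∃ δ, 0 < δ ∧ ∀ (s : ℝ) (x y : B), ‖x‖ ≤ s → ‖y‖ ≤ s → ε * s ≤ ‖x - y‖ →
      ‖x + y‖ ≤ (2 - δ) * s := by
  obtain ⟨δ, hδ, h⟩ := exists_forall_closed_ball_dist_add_le_two_sub B hε
  refine ⟨δ, hδ, fun s x y hx hy hxy => ?_⟩
  rcases (norm_nonneg x |>.trans hx).eq_or_lt with hs | hs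
  · subst hs
    rw [norm_le_zero_iff] at hx hy
    simp [hx, hy]
  · have hn : ∀ z : B, ‖s⁻¹ • z‖ = ‖z‖ / s := by
      intro z
      rw [norm_smul, Real.norm_eq_abs, abs_of_pos (inv_pos.2 hs)]
      field_simp
    have := @h (s⁻¹ • x) (by rw [hn, div_le_one hs]; exact hx) (s⁻¹ • y)
      (by rw [hn, div_le_one hs]; exact hy) (by rw [← smul_sub, hn, le_div_iff₀ hs]; exact hxy)
    rw [← smul_add, hn, div_le_iff₀ hs] at this
    exact this

theorem tendsto_zero_of_uc {ι : Type*} (l : Filter ι) (e s : ι → ℝ) (d : ℝ)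
    (ε δ : ℕ → ℝ) (hε : Tendsto ε atTop (nhds 0)) (hε0 : ∀ j, 0 < ε j) (hδ : ∀ j, 0 < δ j)
    (he : ∀ i, 0 ≤ e i) (hes : ∀ i, e i ≤ 2 * s i) (hs : Tendsto s l (nhds d)) (hd : 0 ≤ d)
    (h : ∀ j i, e i < ε j * s i ∨ d ≤ (1 - δ j / 2) * s i) :
    Tendsto e l (nhds 0) := by
  rcases hd.eq_or_lt with hd | hd
  · refine squeeze_zero he hes ?_
    simpa [← hd] using hs.const_mul 2
  · rw [Metric.tendsto_nhds]
    intro η hη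
    have h1 : Tendsto (fun j => ε j * (d + 1)) atTop (nhds (0 * (d + 1))) := hε.mul_const _
    rw [zero_mul] at h1
    obtain ⟨j, hj⟩ := (h1.eventually_lt_const hη).exists
    have h2 : Tendsto (fun i => (1 - δ j / 2) * s i) l (nhds ((1 - δ j / 2) * d)) :=
      hs.const_mul _
    have h3 : (1 - δ j / 2) * d < d := by nlinarith [mul_pos (hδ j) hd]
    filter_upwards [h2.eventually_lt_const h3, hs.eventually_lt_const (lt_add_one d)]
      with i h4 h5
    rw [Real.dist_0_eq_abs, abs_of_nonneg (he i)]
    rcases h j i with h6 | h6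
    · refine h6.trans (lt_of_le_of_lt ?_ hj)
      exact mul_le_mul_of_nonneg_left h5.le (hε0 j).le
    · linarith

/-- `c` dominates the distance from `u` to all iterates `T^k x`, `k ≥ m`. -/
def Good (G : Set (Ω →ₘ[P] B)) (T : (Ω →ₘ[P] B) → (Ω →ₘ[P] B))
    (u : Ω →ₘ[P] B) (m : ℕ) (c : Ω →ₘ[P] ℝ) : Prop :=
  u ∈ G ∧ ∀ x ∈ G, ∀ k, m ≤ k → ∀ᵐ ω ∂P, ‖u ω - (T^[k] x) ω‖ ≤ c ω

def GoodSet (G : Set (Ω →ₘ[P] B)) (T : (Ω →ₘ[P] B) → (Ω →ₘ[P] B)) : Set (Ω →ₘ[P] ℝ) :=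
  {c | ∃ u m, Good G T u m c}

theorem Good.weaken {G : Set (Ω →ₘ[P] B)} {T : (Ω →ₘ[P] B) → (Ω →ₘ[P] B)}
    {u : Ω →ₘ[P] B} {m m' : ℕ} {c c' : Ω →ₘ[P] ℝ} (h : Good G T u m c) (hm : m ≤ m')
    (hc : c ≤ c') : Good G T u m' c' := by
  refine ⟨h.1, fun x hx k hk => ?_⟩
  filter_upwards [h.2 x hx k (hm.trans hk), AEEqFun.coeFn_le.2 hc] with ω h1 h2
  exact h1.trans h2

theorem goodSet_inf {G : Set (Ω →ₘ[P] B)} {T : (Ω →ₘ[P] B) → (Ω →ₘ[P] B)}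
    (hGcv : LConvex G) (c : Ω →ₘ[P] ℝ) (hc : c ∈ GoodSet G T) (c' : Ω →ₘ[P] ℝ)
    (hc' : c' ∈ GoodSet G T) : c ⊓ c' ∈ GoodSet G T := by
  obtain ⟨u, m, hu⟩ := hc
  obtain ⟨v, m', hv⟩ := hc'
  have hA : MeasurableSet {ω | c ω ≤ c' ω} := measurableSet_le c.measurable c'.measurable
  set A := {ω | c ω ≤ c' ω} with hAdef
  set l : Ω →ₘ[P] ℝ := ind A hA with hl
  have hlae : ∀ᵐ ω ∂P, l ω = A.indicator (fun _ => (1 : ℝ)) ω := AEEqFun.coeFn_mk _ _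
  have hl0 : 0 ≤ l := by
    rw [← AEEqFun.coeFn_le]
    filter_upwards [hlae, AEEqFun.coeFn_zero (α := Ω) (μ := P) (β := ℝ)] with ω h1 h2
    rw [h1, h2]
    exact indicator_nonneg (fun _ _ => zero_le_one) _
  have hl1 : l ≤ 1 := by
    rw [← AEEqFun.coeFn_le]
    filter_upwards [hlae, AEEqFun.coeFn_one (α := Ω) (μ := P) (β := ℝ)] with ω h1 h2
    rw [h1, h2]
    exact indicator_le_self' (fun _ _ => zero_le_one) _
  refine ⟨msmul l u + msmul (1 - l) v, max m m', hGcv u hu.1 v hv.1 l hl0 hl1, ?_⟩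
  intro x hx k hk
  filter_upwards [combo_ae l u v, hlae, hu.2 x hx k (le_trans (le_max_left _ _) hk),
    hv.2 x hx k (le_trans (le_max_right _ _) hk), AEEqFun.coeFn_inf c c'] with ω h1 h2 h3 h4 h5
  rw [h1, h2, h5]
  by_cases hω : ω ∈ A
  · have : c ω ≤ c' ω := hω
    simp [hω, this, h3]
  · have : c' ω ≤ c ω := (not_le.1 (show ¬ c ω ≤ c' ω from hω)).le
    simp [hω, this, h4]

theorem good_uc {G : Set (Ω →ₘ[P] B)} {T : (Ω →ₘ[P] B) → (Ω →ₘ[P] B)}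
    (hGne : G.Nonempty) (hGcv : LConvex G)
    (d : Ω →ₘ[P] ℝ) (hd : d ∈ lowerBounds (GoodSet G T)) (ε δ : ℝ)
    (huc : ∀ (s : ℝ) (x y : B), ‖x‖ ≤ s → ‖y‖ ≤ s → ε * s ≤ ‖x - y‖ →
      ‖x + y‖ ≤ (2 - δ) * s)
    (u v : Ω →ₘ[P] B) (m : ℕ) (c : Ω →ₘ[P] ℝ) (hu : Good G T u m c) (hv : Good G T v m c) :
    ∀ᵐ ω ∂P, ‖u ω - v ω‖ ≤ 2 * c ω ∧
      (‖u ω - v ω‖ < ε * c ω ∨ d ω ≤ (1 - δ / 2) * c ω) := by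
  have hA : MeasurableSet {ω | ε * c ω ≤ ‖u ω - v ω‖} :=
    measurableSet_le (c.measurable.const_mul ε)
      (u.stronglyMeasurable.sub v.stronglyMeasurable).norm.measurable
  set h : Ω → ℝ := fun ω => if ε * c ω ≤ ‖u ω - v ω‖ then (1 - δ / 2) * c ω else c ω with hh
  have hmeas : Measurable h := Measurable.ite hA (c.measurable.const_mul _) c.measurable
  set H : Ω →ₘ[P] ℝ := AEEqFun.mk h hmeas.aestronglyMeasurable with hH
  have hHae : ∀ᵐ ω ∂P, H ω = h ω := AEEqFun.coeFn_mk _ _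
  set l : Ω →ₘ[P] ℝ := AEEqFun.mk (fun _ => (1 / 2 : ℝ)) aestronglyMeasurable_const with hl
  have hlae : ∀ᵐ ω ∂P, l ω = 1 / 2 := AEEqFun.coeFn_mk _ _
  have hl0 : 0 ≤ l := by
    rw [← AEEqFun.coeFn_le]
    filter_upwards [hlae, AEEqFun.coeFn_zero (α := Ω) (μ := P) (β := ℝ)] with ω h1 h2
    rw [h1, h2]
    norm_num
  have hl1 : l ≤ 1 := by
    rw [← AEEqFun.coeFn_le]
    filter_upwards [hlae, AEEqFun.coeFn_one (α := Ω) (μ := P) (β := ℝ)] with ω h1 h2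
    rw [h1, h2]
    norm_num
  have hmem : H ∈ GoodSet G T := by
    refine ⟨msmul l u + msmul (1 - l) v, m, hGcv u hu.1 v hv.1 l hl0 hl1, ?_⟩
    intro x hx k hk
    filter_upwards [combo_ae l u v, hlae, hu.2 x hx k hk, hv.2 x hx k hk, hHae]
      with ω h1 h2 h3 h4 h5
    rw [h1, h2, h5]
    have e1 : (1 / 2 : ℝ) • u ω + (1 - 1 / 2 : ℝ) • v ω - (T^[k] x) ω
        = (1 / 2 : ℝ) • ((u ω - (T^[k] x) ω) + (v ω - (T^[k] x) ω)) := by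
      module
    rw [e1, norm_smul, Real.norm_eq_abs, abs_of_pos (by norm_num : (0 : ℝ) < 1 / 2)]
    simp only [hh]
    split_ifs with hω
    · have := huc (c ω) _ _ h3 h4 (by rw [sub_sub_sub_cancel_right]; exact hω)
      linarith
    · have := norm_add_le (u ω - (T^[k] x) ω) (v ω - (T^[k] x) ω)
      linarith
  obtain ⟨x, hx⟩ := hGne
  filter_upwards [AEEqFun.coeFn_le.2 (hd hmem), hHae, hu.2 x hx m le_rfl, hv.2 x hx m le_rfl]
    with ω h1 h2 h3 h4
  constructor
  · have := norm_sub_le (u ω - (T^[m] x) ω) (v ω - (T^[m] x) ω)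
    rw [sub_sub_sub_cancel_right] at this
    linarith
  · rw [h2] at h1
    simp only [hh] at h1
    split_ifs at h1 with hω
    · exact Or.inr h1
    · exact Or.inl (not_le.1 hω)

/-- If `B` is a uniformly convex Banach space and `G` a nonempty a.s. bounded closed
`L⁰`-convex subset of `L⁰(𝓕,B)`, then every isometric self-mapping of `G` has a fixed
point in the random Chebyshev center `C(G,G)`. -/
theorem fixed_point_of_isometric_uniformConvex
    {Ω : Type*} [MeasurableSpace Ω] {P : Measure Ω} [IsProbabilityMeasure P]
    {B : Type*} [NormedAddCommGroup B] [NormedSpace ℝ B] [CompleteSpace B]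
    [UniformConvexSpace B]
    (G : Set (Ω →ₘ[P] B)) (hGne : G.Nonempty) (hGbd : ASBounded G)
    (hGcl : SeqClosed G) (hGcv : LConvex G)
    (T : (Ω →ₘ[P] B) → (Ω →ₘ[P] B)) (hmaps : Set.MapsTo T G G)
    (hiso : IsometricOn G T) :
    ∃ x ∈ Cc G G, T x = x := by
  have hiter : ∀ k, ∀ x ∈ G, T^[k] x ∈ G := fun k x hx => hmaps.iterate k hx
  have hisoae : ∀ x ∈ G, ∀ y ∈ G, ∀ᵐ ω ∂P, ‖T x ω - T y ω‖ = ‖x ω - y ω‖ := by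
    intro x hx y hy
    filter_upwards [nrm_sub_ae (T x) (T y), nrm_sub_ae x y] with ω h1 h2
    rw [← h1, ← h2, hiso x hx y hy]
  -- the radii `R(G,u)`
  have hR : ∀ u ∈ G, IsLUB ((fun y => nrm (u - y)) '' G) (Rr G u) := by
    intro u hu
    refine lsup_isLUB _ (exists_lub _ (hGne.image _) ?_)
    obtain ⟨ξ, hξ⟩ := hGbd
    refine ⟨ξ + ξ, ?_⟩
    rintro _ ⟨y, hy, rfl⟩
    change nrm (u - y) ≤ ξ + ξ
    rw [nrm_sub_le_iff]
    filter_upwards [AEEqFun.coeFn_add ξ ξ, AEEqFun.coeFn_le.2 (hξ u hu),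
      AEEqFun.coeFn_le.2 (hξ y hy), AEEqFun.coeFn_comp norm continuous_norm u,
      AEEqFun.coeFn_comp norm continuous_norm y] with ω h1 h2 h3 h4 h5
    have h2' : (AEEqFun.comp norm continuous_norm u) ω ≤ ξ ω := h2
    have h3' : (AEEqFun.comp norm continuous_norm y) ω ≤ ξ ω := h3
    rw [h4] at h2'
    rw [h5] at h3'
    simp only [comp_apply] at h2' h3'
    rw [h1, Pi.add_apply]
    exact (norm_sub_le _ _).trans (add_le_add h2' h3')
  have hRgood : ∀ u ∈ G, Good G T u 0 (Rr G u) := by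
    intro u hu
    refine ⟨hu, fun x hx k _ => ?_⟩
    exact (nrm_sub_le_iff _ _ _).1 ((hR u hu).1 ⟨_, hiter k x hx, rfl⟩)
  have hSpos : ∀ c ∈ GoodSet G T, 0 ≤ c := by
    rintro c ⟨u, m, hu⟩
    obtain ⟨x, hx⟩ := hGne
    rw [← AEEqFun.coeFn_le]
    filter_upwards [hu.2 x hx m le_rfl, AEEqFun.coeFn_zero (α := Ω) (μ := P) (β := ℝ)]
      with ω h1 h2
    rw [h2]
    exact (norm_nonneg _).trans h1
  have hSne : (GoodSet G T).Nonempty := by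
    obtain ⟨x, hx⟩ := hGne
    exact ⟨_, x, 0, hRgood x hx⟩
  obtain ⟨d, hd, c, hcS, hcd⟩ := exists_glb_seq (GoodSet G T) hSne 0 hSpos
    (fun a ha b hb => goodSet_inf hGcv a ha b hb)
  have hd0 : ∀ᵐ ω ∂P, 0 ≤ d ω := by
    filter_upwards [AEEqFun.coeFn_le.2 (hd.2 hSpos),
      AEEqFun.coeFn_zero (α := Ω) (μ := P) (β := ℝ)] with ω h1 h2
    rwa [h2] at h1
  choose u m hu using hcS
  have huc : ∀ j : ℕ, ∃ δ, 0 < δ ∧ ∀ (s : ℝ) (x y : B), ‖x‖ ≤ s → ‖y‖ ≤ s →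
      (1 / ((j : ℝ) + 1)) * s ≤ ‖x - y‖ → ‖x + y‖ ≤ (2 - δ) * s :=
    fun j => uc_scaled B _ (by positivity)
  choose δ hδ hucδ using huc
  -- the minimizing sequence is a.s. Cauchy
  have hpair : ∀ᵐ ω ∂P, ∀ (j : ℕ) (i : ℕ × ℕ), ‖u i.1 ω - u i.2 ω‖ ≤ 2 * (max (c i.1 ω) (c i.2 ω)) ∧
      (‖u i.1 ω - u i.2 ω‖ < (1 / ((j : ℝ) + 1)) * (max (c i.1 ω) (c i.2 ω)) ∨
        d ω ≤ (1 - δ j / 2) * (max (c i.1 ω) (c i.2 ω))) := by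
    rw [ae_all_iff]
    intro j
    rw [ae_all_iff]
    intro i
    filter_upwards [good_uc hGne hGcv d hd.1 _ _ (hucδ j) (u i.1) (u i.2) (max (m i.1) (m i.2))
      (c i.1 ⊔ c i.2) ((hu _).weaken (le_max_left _ _) le_sup_left)
      ((hu _).weaken (le_max_right _ _) le_sup_right), AEEqFun.coeFn_sup (c i.1) (c i.2)]
      with ω h1 h2
    rw [h2] at h1
    exact h1
  have hcauchy : ∀ᵐ ω ∂P, ∃ p : B, Tendsto (fun n => u n ω) atTop (nhds p) := by
    filter_upwards [hpair, hcd, hd0] with ω h1 h2 h3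
    apply cauchySeq_tendsto_of_complete
    rw [cauchySeq_iff_tendsto_dist_atTop_0]
    simp only [dist_eq_norm]
    refine tendsto_zero_of_uc _ _ (fun i : ℕ × ℕ => max (c i.1 ω) (c i.2 ω)) (d ω) _ δ
      tendsto_one_div_add_atTop_nhds_zero_nat (fun j => by positivity) hδ
      (fun i => norm_nonneg _) (fun i => (h1 0 i).1) ?_ h3 (fun j i => (h1 j i).2)
    have h4 : Tendsto (fun i : ℕ × ℕ => c i.1 ω) atTop (nhds (d ω)) := by
      rw [← prod_atTop_atTop_eq]; exact h2.comp tendsto_fst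
    have h5 : Tendsto (fun i : ℕ × ℕ => c i.2 ω) atTop (nhds (d ω)) := by
      rw [← prod_atTop_atTop_eq]; exact h2.comp tendsto_snd
    simpa using h4.max h5
  obtain ⟨f, hf, hlim⟩ := exists_stronglyMeasurable_limit_of_tendsto_ae (μ := P)
    (f := fun n => (u n : Ω → B)) (fun n => (u n).aestronglyMeasurable) hcauchy
  set p : Ω →ₘ[P] B := AEEqFun.mk f hf.aestronglyMeasurable with hp
  have hpf : ∀ᵐ ω ∂P, p ω = f ω := AEEqFun.coeFn_mk _ _
  have hup : ∀ᵐ ω ∂P, Tendsto (fun n => u n ω) atTop (nhds (p ω)) := by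
    filter_upwards [hlim, hpf] with ω h1 h2
    rw [h2]; exact h1
  have hpG : p ∈ G := hGcl u p (fun n => (hu n).1)
    (tendstoInMeasure_of_tendsto_ae (fun n => (u n).aestronglyMeasurable) hup)
  -- `p` is a fixed point
  have hTgood : ∀ n, Good G T (T (u n)) (m n + 1) (c n) := by
    intro n
    refine ⟨hmaps (hu n).1, fun x hx k hk => ?_⟩
    obtain ⟨j, rfl⟩ : ∃ j, k = j + 1 := ⟨k - 1, by omega⟩
    rw [iterate_succ_apply']
    filter_upwards [hisoae (u n) (hu n).1 _ (hiter j x hx), (hu n).2 x hx j (by omega)]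
      with ω h1 h2
    rw [h1]; exact h2
  have hTp : T p = p := by
    have hpairT : ∀ᵐ ω ∂P, ∀ (j : ℕ) (n : ℕ), ‖u n ω - T (u n) ω‖ ≤ 2 * c n ω ∧
        (‖u n ω - T (u n) ω‖ < (1 / ((j : ℝ) + 1)) * c n ω ∨
          d ω ≤ (1 - δ j / 2) * c n ω) := by
      rw [ae_all_iff]
      intro j
      rw [ae_all_iff]
      intro n
      exact good_uc hGne hGcv d hd.1 _ _ (hucδ j) (u n) (T (u n)) (m n + 1)
        (c n) ((hu _).weaken (Nat.le_succ _) le_rfl) (hTgood n)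
    have hTu : ∀ᵐ ω ∂P, ∀ n, ‖T (u n) ω - T p ω‖ = ‖u n ω - p ω‖ := by
      rw [ae_all_iff]
      exact fun n => hisoae _ (hu n).1 _ hpG
    apply AEEqFun.ext
    filter_upwards [hpairT, hTu, hup, hcd, hd0] with ω h1 h2 h3 h4 h5
    have h6 : Tendsto (fun n => ‖u n ω - T (u n) ω‖) atTop (nhds 0) :=
      tendsto_zero_of_uc _ _ (fun n => c n ω) (d ω) _ δ
        tendsto_one_div_add_atTop_nhds_zero_nat (fun j => by positivity) hδ
        (fun i => norm_nonneg _) (fun i => (h1 0 i).1) h4 h5 (fun j i => (h1 j i).2)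
    have h7 : Tendsto (fun n => ‖u n ω - p ω‖) atTop (nhds 0) :=
      tendsto_iff_norm_sub_tendsto_zero.1 h3
    have h8 := (h7.add h6).add h7
    have h9 : ‖T p ω - p ω‖ ≤ 0 + 0 + 0 := by
      refine ge_of_tendsto' h8 fun n => ?_
      have e : T p ω - p ω = (u n ω - p ω) - (u n ω - T (u n) ω) - (T (u n) ω - T p ω) := by abel
      calc ‖T p ω - p ω‖ = ‖(u n ω - p ω) - (u n ω - T (u n) ω) - (T (u n) ω - T p ω)‖ := by
            rw [← e]
        _ ≤ ‖u n ω - p ω‖ + ‖u n ω - T (u n) ω‖ + ‖T (u n) ω - T p ω‖ :=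
            (norm_sub_le _ _).trans (add_le_add (norm_sub_le _ _) le_rfl)
        _ = _ := by rw [h2 n]
    have h10 : ‖T p ω - p ω‖ ≤ 0 := by simpa using h9
    exact sub_eq_zero.1 (norm_le_zero_iff.1 h10)
  -- `p` is a center
  have hinv : ∀ k, ∀ x ∈ G, ∀ᵐ ω ∂P, ‖p ω - (T^[k] x) ω‖ = ‖p ω - x ω‖ := by
    intro k
    induction k with
    | zero => exact fun x _ => Eventually.of_forall fun ω => rfl
    | succ k ih =>
      intro x hx
      filter_upwards [ih (T x) (hmaps hx), hisoae p hpG x hx] with ω h1 h2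
      rw [iterate_succ_apply, h1, ← h2, hTp]
  have hRp : Rr G p ≤ d := by
    refine (hR p hpG).2 ?_
    rintro _ ⟨x, hx, rfl⟩
    change nrm (p - x) ≤ d
    rw [nrm_sub_le_iff]
    have h1 : ∀ᵐ ω ∂P, ∀ n, ‖p ω - (T^[m n] x) ω‖ = ‖p ω - x ω‖ := by
      rw [ae_all_iff]
      exact fun n => hinv _ x hx
    have h2 : ∀ᵐ ω ∂P, ∀ n, ‖u n ω - (T^[m n] x) ω‖ ≤ c n ω := by
      rw [ae_all_iff]
      exact fun n => (hu n).2 x hx _ le_rfl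
    filter_upwards [h1, h2, hup, hcd] with ω h1 h2 h3 h4
    have h7 : Tendsto (fun n => ‖u n ω - p ω‖) atTop (nhds 0) :=
      tendsto_iff_norm_sub_tendsto_zero.1 h3
    have h8 := h7.add h4
    rw [zero_add] at h8
    refine ge_of_tendsto' h8 fun n => ?_
    rw [← h1 n]
    have := norm_sub_le_norm_sub_add_norm_sub (p ω) (u n ω) ((T^[m n] x) ω)
    rw [norm_sub_rev (p ω) (u n ω)] at this
    linarith [h2 n]
  refine ⟨p, ⟨hpG, ?_⟩, hTp⟩
  symm
  apply linf_eq
  refine IsLeast.isGLB ⟨⟨p, hpG, rfl⟩, ?_⟩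
  rintro _ ⟨v, hv, rfl⟩
  exact hRp.trans (hd.1 ⟨v, 0, hRgood v hv⟩)

end RNM
end
end
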